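/- A unital C*-algebra A admits a well-defined diagonal sum on automorphism orbits — i.e., for all x, x', y, y' in A, if x' lies in the automorphism orbit of x and y' lies in the automorphism orbit of y, then diag(x', y') lies in the automorphism orbit of diag(x, y) in M₂(A) — if and only if every *-automorphism of A is locally inner. -/

import Mathlib

open Matrix

/-- The `*`-homomorphism placing an element of `A` in the `k`-th diagonal entry of a matrix. -/
def diagonalCorner {A n : Type*} [CStarAlgebra A] [Fintype n] [DecidableEq n] (k : n) :
    A →⋆ₙₐ[ℂ] Matrix n n A where
  toFun x := single k k x
  map_zero' := single_zero k k
  map_add' := single_add k k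
  map_mul' x y := (single_mul_single_same x k k k y).symm
  map_smul' c x := (smul_single c k k x).symm
  map_star' x := by
    rw [star_eq_conjTranspose, conjTranspose_single]

theorem norm_map_single_entry_le {A n : Type*} [CStarAlgebra A] [Fintype n] [DecidableEq n]
    (γ : Matrix n n A ≃⋆ₐ[ℂ] Matrix n n A) (k : n) (x : A) (i j : n) :
    ‖γ (single k k x) i j‖ ≤ ‖x‖ := by
  let _ := CStarAlgebra.spectralOrder A
  let _ := CStarAlgebra.spectralOrderedRing A
  let e : Matrix n n A ≃⋆ₐ[ℂ] CStarMatrix n n A := CStarMatrix.ofMatrixStarAlgEquiv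
  let φ : A →⋆ₙₐ[ℂ] CStarMatrix n n A :=
    (NonUnitalStarAlgHomClass.toNonUnitalStarAlgHom (γ.trans e)).comp (diagonalCorner k)
  exact (CStarMatrix.norm_entry_le_norm (M := φ x)).trans
    (NonUnitalStarAlgHom.norm_apply_le φ x)

theorem single_zero_zero_eq_diagonal_mul {R : Type*} [Semiring R] (a b : R) :
    single 0 0 a = diagonal ![a, b] * single 0 0 1 := by
  ext i j
  fin_cases i <;> fin_cases j <;> simp

theorem single_one_one_eq_diagonal_sub_smul_mul {R : Type*} [Ring R] [Algebra ℂ R] (a b : R)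
    (c : ℂ) :
    single 1 1 b = (diagonal ![a, b + c • 1] - c • 1) * (1 - single 0 0 1) := by
  ext i j
  fin_cases i <;> fin_cases j <;> simp [mul_apply]

theorem eq_zero_of_smul_eq_mul_sub_mul {A : Type*} [CStarAlgebra A] {v w q : A} {c : ℂ} {r : ℝ}
    (hv : ‖v‖ ≤ r) (hw : ‖w‖ ≤ r) (hc : 2 * r < ‖c‖) (h : c • q = v * q - q * w) : q = 0 := by
  by_contra hq
  have hq' : 0 < ‖q‖ := norm_pos_iff.mpr hq
  have h1 : ‖c‖ * ‖q‖ ≤ ‖v‖ * ‖q‖ + ‖q‖ * ‖w‖ := by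
    rw [← norm_smul, h]
    exact (norm_sub_le _ _).trans (add_le_add (norm_mul_le _ _) (norm_mul_le _ _))
  nlinarith

theorem IsStarProjection.eq_zero_of_norm_mul_add_smul_le {A : Type*} [CStarAlgebra A] {w q : A}
    {c : ℂ} {r : ℝ} (hq : IsStarProjection q) (hw : ‖w‖ ≤ r) (hc : 2 * r < ‖c‖)
    (h : ‖w * q + c • q‖ ≤ r) : q = 0 := by
  by_contra hq0
  have hpos : 0 < ‖q‖ := norm_pos_iff.mpr hq0
  have hsq : ‖q‖ = ‖q‖ * ‖q‖ := by
    rw [← CStarRing.norm_star_mul_self, hq.isSelfAdjoint.star_eq, hq.isIdempotentElem.eq]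
  have hone : ‖q‖ = 1 := by
    have := mul_right_cancel₀ hpos.ne' ((one_mul ‖q‖).trans hsq)
    exact this.symm
  have h1 : ‖c • q‖ ≤ ‖w * q + c • q‖ + ‖w * q‖ := by
    simpa using norm_sub_le (w * q + c • q) (w * q)
  have h2 := norm_mul_le w q
  rw [norm_smul, hone, mul_one] at h1
  rw [hone, mul_one] at h2
  linarith

theorem map_corner_eq_of_separated {A : Type*} [CStarAlgebra A] {x x' y y' : A} {c : ℂ} {r : ℝ}
    (hx : ‖x‖ ≤ r) (hx' : ‖x'‖ ≤ r) (hy : ‖y‖ ≤ r) (hy' : ‖y'‖ ≤ r) (hc : 2 * r < ‖c‖)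
    (γ : Matrix (Fin 2) (Fin 2) A ≃⋆ₐ[ℂ] Matrix (Fin 2) (Fin 2) A)
    (h : γ (diagonal ![x, y + c • 1]) = diagonal ![x', y' + c • 1]) :
    γ (single 0 0 1) = single 0 0 1 := by
  have hstar : star (γ (single 0 0 1)) = γ (single 0 0 1) := by
    rw [← map_star, star_eq_conjTranspose, conjTranspose_single, star_one]
  have hidem : γ (single 0 0 1) * γ (single 0 0 1) = γ (single 0 0 1) := by
    rw [← map_mul, single_mul_single_same, mul_one]
  have hleft : diagonal ![x', y' + c • 1] * γ (single 0 0 1) = γ (single 0 0 x) := by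
    rw [← h, ← map_mul, ← single_zero_zero_eq_diagonal_mul]
  have hright : γ (single 0 0 1) * diagonal ![x', y' + c • 1] = γ (single 0 0 x) := by
    rw [← h, ← map_mul]
    congr 1
    ext i j
    fin_cases i <;> fin_cases j <;> simp
  have hcompl : (diagonal ![x', y' + c • 1] - c • 1) * (1 - γ (single 0 0 1)) =
      γ (single 1 1 y) := by
    rw [← h, ← map_one γ, ← map_smul, ← map_sub, ← map_sub, ← map_mul,
      ← single_one_one_eq_diagonal_sub_smul_mul]
  have hnx := norm_map_single_entry_le γ 0 x 1 1
  have hny := norm_map_single_entry_le γ 1 y 0 0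
  have hcomm := hleft.trans hright.symm
  rw [← hleft] at hnx
  rw [← hcompl] at hny
  generalize γ (single 0 0 1) = p at *
  have h01 : p 0 1 = 0 := by
    have := congrFun₂ hcomm 0 1
    simp [mul_add] at this
    refine eq_zero_of_smul_eq_mul_sub_mul hx' hy' hc ?_
    rw [this]; abel
  have h10 : p 1 0 = 0 := by
    have := congrFun₂ hstar 1 0
    simpa [star_apply, h01] using this.symm
  have s0 : star (p 0 0) = p 0 0 := congrFun₂ hstar 0 0
  have s1 : star (p 1 1) = p 1 1 := congrFun₂ hstar 1 1
  have i0 : p 0 0 * p 0 0 = p 0 0 := by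
    simpa [mul_apply, h01] using congrFun₂ hidem 0 0
  have i1 : p 1 1 * p 1 1 = p 1 1 := by
    simpa [mul_apply, h10] using congrFun₂ hidem 1 1
  have h11 : p 1 1 = 0 := by
    refine IsStarProjection.eq_zero_of_norm_mul_add_smul_le ⟨i1, s1⟩ hy' hc ?_
    refine le_trans (le_of_eq ?_) (hnx.trans hx)
    simp [add_mul]
  have h00 : 1 - p 0 0 = 0 := by
    have hP : IsStarProjection (p 0 0) := ⟨i0, s0⟩
    refine hP.one_sub.eq_zero_of_norm_mul_add_smul_le (c := -c) hx' (by simpa using hc) ?_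
    refine le_trans (le_of_eq ?_) (hny.trans hy)
    congr 1
    simp [mul_apply, h10]
    rw [sub_mul, smul_one_mul, ← sub_eq_add_neg]
  ext i j
  fin_cases i <;> fin_cases j <;> simp [h01, h10, h11, (sub_eq_zero.mp h00).symm]

theorem exists_unitary_conj_of_map_corner {A : Type*} [CStarAlgebra A] {x x' y' : A}
    (γ : Matrix (Fin 2) (Fin 2) A ≃⋆ₐ[ℂ] Matrix (Fin 2) (Fin 2) A)
    (hx : γ (single 0 0 x) = single 0 0 x') (hy : γ (single 1 1 x) = single 1 1 y')
    (h : γ (single 0 0 1) = single 0 0 1) :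
    ∃ u ∈ unitary A, x' = u * y' * star u := by
  have h' : γ (single 1 1 1) = single 1 1 1 := by
    have e : (single 1 1 1 : Matrix (Fin 2) (Fin 2) A) = 1 - single 0 0 1 := by
      ext i j
      fin_cases i <;> fin_cases j <;> simp
    rw [e, map_sub, h, map_one]
  have hw : γ (single 0 1 1) = single 0 1 (γ (single 0 1 1) 0 1) := by
    have e : γ (single 0 1 1) = single 0 0 1 * γ (single 0 1 1) * single 1 1 1 := by
      nth_rewrite 1 [← h, ← h']
      simp [← map_mul]
    nth_rewrite 1 [e]
    ext i j
    fin_cases i <;> fin_cases j <;> simp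
  generalize γ (single 0 1 1) 0 1 = w at hw
  have hw' : γ (single 1 0 1) = single 1 0 (star w) := by
    have e : (single 1 0 1 : Matrix (Fin 2) (Fin 2) A) = star (single 0 1 1) := by
      rw [star_eq_conjTranspose, conjTranspose_single, star_one]
    rw [e, map_star, hw, star_eq_conjTranspose, conjTranspose_single]
  refine ⟨w, Unitary.mem_iff.mpr ⟨?_, ?_⟩, ?_⟩
  · have e : γ (single 1 0 1 * single 0 1 1) = single 1 1 1 := by simpa using h'
    rw [map_mul, hw, hw'] at e
    simpa using congrFun₂ e 1 1
  · have e : γ (single 0 1 1 * single 1 0 1) = single 0 0 1 := by simpa using h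
    rw [map_mul, hw, hw'] at e
    simpa using congrFun₂ e 0 0
  · have e : γ (single 0 1 1 * single 1 1 x * single 1 0 1) = single 0 0 x' := by simpa using hx
    rw [map_mul, map_mul, hw, hw', hy] at e
    simpa using (congrFun₂ e 0 0).symm

theorem exists_unitary_conj_of_map_diagonal {A : Type*} [CStarAlgebra A] {x x' y' : A} {c : ℂ}
    {r : ℝ} (hx : ‖x‖ ≤ r) (hx' : ‖x'‖ ≤ r) (hy' : ‖y'‖ ≤ r) (hc : 2 * r < ‖c‖)
    (γ : Matrix (Fin 2) (Fin 2) A ≃⋆ₐ[ℂ] Matrix (Fin 2) (Fin 2) A)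
    (h : γ (diagonal ![x, x + c • 1]) = diagonal ![x', y' + c • 1]) :
    ∃ u ∈ unitary A, x' = u * y' * star u := by
  have hE := map_corner_eq_of_separated hx hx' hx hy' hc γ h
  refine exists_unitary_conj_of_map_corner (x := x) γ ?_ ?_ hE
  · rw [single_zero_zero_eq_diagonal_mul x (x + c • 1), map_mul, h, hE,
      ← single_zero_zero_eq_diagonal_mul]
  · rw [single_one_one_eq_diagonal_sub_smul_mul x x c, map_mul, map_sub, map_sub, map_smul,
      map_one, h, hE, ← single_one_one_eq_diagonal_sub_smul_mul]

/-- **Corollary.** A unital C*-algebra `A` admits a well-defined diagonal sum on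
automorphism orbits if and only if all automorphisms of `A` are locally inner. -/
theorem diagonal_sum_wellDefined_iff_all_locallyInner (A : Type*) [CStarAlgebra A] :
    (∀ x x' y y' : A,
      (∃ θ : A ≃⋆ₐ[ℂ] A, θ x = x') →
      (∃ σ : A ≃⋆ₐ[ℂ] A, σ y = y') →
      ∃ γ : Matrix (Fin 2) (Fin 2) A ≃⋆ₐ[ℂ] Matrix (Fin 2) (Fin 2) A,
        γ (Matrix.diagonal ![x, y]) = Matrix.diagonal ![x', y']) ↔
    (∀ θ : A ≃⋆ₐ[ℂ] A, ∀ x : A, ∃ u ∈ unitary A, θ x = u * x * star u) := by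
  constructor
  · intro H θ x
    have hθ : ‖θ x‖ ≤ ‖x‖ := NonUnitalStarAlgHom.norm_apply_le θ x
    let c : ℂ := ((2 * ‖x‖ + 1 : ℝ) : ℂ)
    have hc : 2 * ‖x‖ < ‖c‖ := by
      rw [Complex.norm_of_nonneg (by positivity)]
      linarith
    obtain ⟨γ, hγ⟩ := H x (θ x) (x + c • 1) (x + c • 1) ⟨θ, rfl⟩ ⟨StarAlgEquiv.refl ℂ A, rfl⟩
    exact exists_unitary_conj_of_map_diagonal le_rfl hθ le_rfl hc γ hγ
  · rintro H x _ y _ ⟨θ, rfl⟩ ⟨σ, rfl⟩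
    obtain ⟨u, hu, hux⟩ := H θ x
    obtain ⟨v, hv, hvy⟩ := H σ y
    have hU : diagonal ![u, v] ∈ unitary (Matrix (Fin 2) (Fin 2) A) := by
      rw [Unitary.mem_iff] at hu hv ⊢
      constructor
      · ext i j
        fin_cases i <;> fin_cases j <;> simp [star_eq_conjTranspose, hu.1, hv.1]
      · ext i j
        fin_cases i <;> fin_cases j <;> simp [star_eq_conjTranspose, hu.2, hv.2]
    refine ⟨Unitary.conjStarAlgAut ℂ _ ⟨_, hU⟩, ?_⟩
    rw [Unitary.conjStarAlgAut_apply]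
    ext i j
    fin_cases i <;> fin_cases j <;> simp [star_eq_conjTranspose, hux, hvy]
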